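/- arXiv:math/0305169 — 6 statements merged into one kernel-verified Lean document; each statement's English description precedes it below -/
import Mathlib

section
/- Let φ : ℝ² → S² be the injective continuous map obtained by composing the homeomorphism (x,y) ↦ (x/(1+√(x²+y²)), y/(1+√(x²+y²))) of ℝ² onto the open unit disk with the quotient map collapsing the boundary circle of the closed unit disk D² to a single point p (so that D²/S¹ ≅ S²). Let P be the pushout, in the category of topological spaces, of the diagram ℝ ← ℝ×ℝ → S², where the left map is the first projection (x,y) ↦ x and the right map is φ. Then the underlying set of P is the disjoint union ℝ ⊔ {p}, and a subset Ω of P is open if and only if either p ∉ Ω and Ω is an open subset of ℝ, or Ω = P. -/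
set_option maxHeartbeats 1000000
noncomputable section

/-- The Euclidean plane. -/
abbrev E2 : Type := EuclideanSpace ℝ (Fin 2)

/-- The Euclidean space `ℝ³`. -/
abbrev E3 : Type := EuclideanSpace ℝ (Fin 3)

/-- The closed unit disk `D²`. -/
abbrev Disk : Type := Metric.closedBall (0 : E2) 1

/-- The unit sphere `S²`. -/
abbrev Sph : Type := Metric.sphere (0 : E3) 1

/-- The homeomorphism of the plane onto the open unit disk,
`(x,y) ↦ (x/(1+√(x²+y²)), y/(1+√(x²+y²)))`. -/
def psi (v : E2) : E2 := (1 + ‖v‖)⁻¹ • v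

theorem psi_mem_disk (v : E2) : psi v ∈ Metric.closedBall (0 : E2) 1 := by
  have h0 : (0 : ℝ) ≤ ‖v‖ := norm_nonneg v
  have h1 : (0 : ℝ) < 1 + ‖v‖ := by linarith
  rw [Metric.mem_closedBall, dist_zero_right, psi, norm_smul, norm_inv, Real.norm_eq_abs,
    abs_of_pos h1, inv_mul_le_one₀] <;> linarith

/-- The map `ψ` viewed as a map into the closed disk. -/
def psiD (v : E2) : Disk := ⟨psi v, psi_mem_disk v⟩

end
noncomputable section

/-- The relation generating the pushout of `ℝ ← ℝ×ℝ → S²`, where the left map is the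
first projection and the right map is `φ = c ∘ ψ`. -/
def pushRel (c : Disk → Sph) : (ℝ ⊕ Sph) → (ℝ ⊕ Sph) → Prop := fun a b =>
  ∃ v : E2, a = Sum.inl (v 0) ∧ b = Sum.inr (c (psiD v))

/-- The pushout, in the category of topological spaces, of `ℝ ← ℝ×ℝ → S²`:
the quotient of the topological disjoint union `ℝ ⊕ S²` identifying the two images of
each point of `ℝ×ℝ`, with the final topology. -/
def Push (c : Disk → Sph) : Type := Quot (pushRel c)

instance (c : Disk → Sph) : TopologicalSpace (Push c) :=
  inferInstanceAs (TopologicalSpace (Quot (pushRel c)))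

/-- The canonical set map from `ℝ ⊔ {p}` to the pushout of `ℝ ← ℝ×ℝ → S²`. -/
def pushCompare (c : Disk → Sph) (p : Sph) : ℝ ⊕ PUnit → Push c := fun a =>
  match a with
  | Sum.inl x => Quot.mk _ (Sum.inl x)
  | Sum.inr _ => Quot.mk _ (Sum.inr p)

/-- The inverse of `psi` on the open unit disk. -/
def psiInv (u : E2) : E2 := (1 - ‖u‖)⁻¹ • u

theorem norm_psi (v : E2) : ‖psi v‖ = (1 + ‖v‖)⁻¹ * ‖v‖ := by
  have h0 : (0 : ℝ) ≤ ‖v‖ := norm_nonneg v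
  rw [psi, norm_smul, norm_inv, Real.norm_eq_abs, abs_of_pos (by linarith)]

theorem norm_psi_lt_one (v : E2) : ‖psi v‖ < 1 := by
  have h0 : (0 : ℝ) ≤ ‖v‖ := norm_nonneg v
  rw [norm_psi, inv_mul_lt_one₀] <;> linarith

theorem psiInv_psi (v : E2) : psiInv (psi v) = v := by
  have h0 : (1 : ℝ) + ‖v‖ ≠ 0 := by have := norm_nonneg v; positivity
  have h1 : (1 : ℝ) - (1 + ‖v‖)⁻¹ * ‖v‖ = (1 + ‖v‖)⁻¹ := by field_simp; ring
  rw [psiInv, norm_psi, h1, psi, smul_smul, inv_inv, mul_inv_cancel₀ h0, one_smul]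

theorem psi_psiInv {u : E2} (hu : ‖u‖ < 1) : psi (psiInv u) = u := by
  have h0 : (1 : ℝ) - ‖u‖ ≠ 0 := by linarith
  have h1 : (1 : ℝ) + (1 - ‖u‖)⁻¹ * ‖u‖ = (1 - ‖u‖)⁻¹ := by field_simp; ring
  rw [psi, psiInv, norm_smul, norm_inv, Real.norm_eq_abs, abs_of_pos (by linarith), h1,
    smul_smul, inv_inv, mul_inv_cancel₀ h0, one_smul]

theorem continuous_psiD : Continuous psiD := by
  have h : Continuous fun v : E2 => 1 + ‖v‖ := by fun_prop
  refine Continuous.subtype_mk ((h.inv₀ fun v => ?_).smul continuous_id) _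
  have := norm_nonneg v
  positivity

theorem continuousOn_psiInv : ContinuousOn psiInv {u | ‖u‖ < 1} := by
  have h : Continuous fun u : E2 => 1 - ‖u‖ := by fun_prop
  refine (h.continuousOn.inv₀ fun u hu => ?_).smul continuousOn_id
  have : ‖u‖ < 1 := hu
  linarith

theorem psiD_injective : Function.Injective psiD := fun v w h => by
  have h' : psi v = psi w := congrArg Subtype.val h
  rw [← psiInv_psi v, h', psiInv_psi]

theorem psiD_psiInv {u : Disk} (hu : ‖u.1‖ < 1) : psiD (psiInv u.1) = u :=
  Subtype.ext (psi_psiInv hu)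

theorem Disk.norm_lt_one_or_eq_one (u : Disk) : ‖u.1‖ < 1 ∨ ‖u.1‖ = 1 :=
  lt_or_eq_of_le (mem_closedBall_zero_iff.1 u.2)

theorem Disk.exists_norm_eq_one : ∃ u : Disk, ‖u.1‖ = 1 := by
  have h : ‖(EuclideanSpace.single 0 1 : E2)‖ = 1 := by simp
  exact ⟨⟨_, by simp [h]⟩, h⟩

theorem Push.mk_inr_eq (c : Disk → Sph) (v : E2) :
    (Quot.mk _ (Sum.inr (c (psiD v))) : Push c) = Quot.mk _ (Sum.inl (v 0)) :=
  (Quot.sound ⟨v, rfl, rfl⟩).symm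

theorem comp_psiD_injective {c : Disk → Sph}
    (hc_fib : ∀ u v : Disk, c u = c v ↔ (u = v ∨ (‖u.1‖ = 1 ∧ ‖v.1‖ = 1))) :
    Function.Injective (fun v : E2 => c (psiD v)) := fun v w h => by
  rcases (hc_fib _ _).1 h with h | h
  · exact psiD_injective h
  · exact absurd h.1 (norm_psi_lt_one v).ne

open Classical in
/-- The map from `ℝ ⊔ S²` to `ℝ ⊔ {p}` that induces the inverse of `pushCompare`. -/
def collapse (c : Disk → Sph) : ℝ ⊕ Sph → ℝ ⊕ PUnit
  | Sum.inl x => Sum.inl x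
  | Sum.inr s => if h : ∃ v : E2, c (psiD v) = s then Sum.inl (h.choose 0) else Sum.inr ⟨⟩

theorem collapse_eq_of_pushRel {c : Disk → Sph}
    (hinj : Function.Injective (fun v : E2 => c (psiD v))) (a b : ℝ ⊕ Sph)
    (h : pushRel c a b) : collapse c a = collapse c b := by
  obtain ⟨v, rfl, rfl⟩ := h
  have hv : ∃ w : E2, c (psiD w) = c (psiD v) := ⟨v, rfl⟩
  have : hv.choose = v := hinj hv.choose_spec
  simp only [collapse]
  rw [dif_pos hv, this]

theorem pushCompare_injective {c : Disk → Sph}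
    (hinj : Function.Injective (fun v : E2 => c (psiD v))) {p : Sph}
    (hp : ∀ v, c (psiD v) ≠ p) : Function.Injective (pushCompare c p) := by
  refine Function.LeftInverse.injective
    (g := Quot.lift (collapse c) (collapse_eq_of_pushRel hinj)) ?_
  rintro (x | _)
  · rfl
  · exact dif_neg fun ⟨v, hv⟩ => hp v hv

theorem pushCompare_surjective {c : Disk → Sph} (hc : Function.Surjective c) {p : Sph}
    (hp : ∀ u : Disk, ‖u.1‖ = 1 → c u = p) : Function.Surjective (pushCompare c p) := by
  rintro ⟨x | s⟩
  · exact ⟨Sum.inl x, rfl⟩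
  · obtain ⟨u, rfl⟩ := hc s
    rcases u.norm_lt_one_or_eq_one with hu | hu
    · refine ⟨Sum.inl (psiInv u.1 0), ?_⟩
      have := Push.mk_inr_eq c (psiInv u.1)
      rw [psiD_psiInv hu] at this
      exact this.symm
    · refine ⟨Sum.inr ⟨⟩, ?_⟩
      rw [hp u hu]
      rfl

theorem Push.isOpen_iff {c : Disk → Sph} (hc : Topology.IsQuotientMap c) (Ω : Set (Push c)) :
    IsOpen Ω ↔ IsOpen {x : ℝ | (Quot.mk _ (Sum.inl x) : Push c) ∈ Ω} ∧
      IsOpen {u : Disk | (Quot.mk _ (Sum.inr (c u)) : Push c) ∈ Ω} := by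
  have hq : Topology.IsQuotientMap (Quot.mk (pushRel c)) := isQuotientMap_quot_mk
  have h1 : IsOpen Ω ↔ IsOpen (Quot.mk (pushRel c) ⁻¹' Ω) := hq.isOpen_preimage.symm
  rw [h1, isOpen_sum_iff, ← hc.isOpen_preimage (s := Sum.inr ⁻¹' _)]
  rfl

/-- An open set of the disk containing the boundary circle meets the image under `ψ` of every
vertical line. -/
theorem exists_psiD_mem_of_isOpen {V : Set Disk} (hV : IsOpen V)
    (hbd : ∀ u : Disk, ‖u.1‖ = 1 → u ∈ V) (x : ℝ) : ∃ v : E2, v 0 = x ∧ psiD v ∈ V := by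
  have : CompactSpace Disk := isCompact_iff_compactSpace.1 (isCompact_closedBall _ _)
  have hcont : ContinuousOn (fun u : Disk => psiInv u.1) Vᶜ :=
    continuousOn_psiInv.comp continuous_subtype_val.continuousOn fun u hu =>
      u.norm_lt_one_or_eq_one.resolve_right fun h => hu (hbd u h)
  obtain ⟨R, hR⟩ :=
    (hV.isClosed_compl.isCompact.image_of_continuousOn hcont).isBounded.exists_norm_le
  refine ⟨!₂[x, |R| + 1], rfl, by_contra fun hv => ?_⟩
  have h1 := hR _ ⟨_, hv, psiInv_psi _⟩
  have h2 := PiLp.norm_apply_le (!₂[x, |R| + 1] : E2) 1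
  have h3 : ‖(!₂[x, |R| + 1] : E2) 1‖ = |R| + 1 :=
    abs_of_nonneg (show (0 : ℝ) ≤ |R| + 1 by positivity)
  linarith [le_abs_self R]

/-- Let `φ : ℝ² → S²` be the injective continuous map obtained by composing the
homeomorphism `ψ : (x,y) ↦ (x/(1+√(x²+y²)), y/(1+√(x²+y²)))` of the plane onto the open
unit disk with the quotient map `c` collapsing the boundary circle of `D²` to the point
`p` (so that `D²/S¹ ≅ S²`). Then the pushout of `ℝ ← ℝ×ℝ → S²` (first projection on the
left, `φ` on the right) has underlying set `ℝ ⊔ {p}`, and a subset `Ω` is open iff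
either `p ∉ Ω` and `Ω` is an open subset of `ℝ`, or `Ω` is the whole pushout. -/
theorem pushout_of_first_projection_and_phi
    (c : Disk → Sph) (hc_cont : Continuous c) (hc_quot : Topology.IsQuotientMap c)
    (hc_fib : ∀ u v : Disk, c u = c v ↔ (u = v ∨ (‖u.1‖ = 1 ∧ ‖v.1‖ = 1)))
    (p : Sph) (hp : ∀ u : Disk, ‖u.1‖ = 1 → c u = p) :
    -- `φ` is injective and continuous
    Function.Injective (fun v : E2 => c (psiD v)) ∧
    Continuous (fun v : E2 => c (psiD v)) ∧
    -- the underlying set of the pushout is `ℝ ⊔ {p}`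
    Function.Bijective (pushCompare c p) ∧
    -- description of the open sets of the pushout
    (∀ Ω : Set (Push c), IsOpen Ω ↔
      ((Quot.mk _ (Sum.inr p) ∉ Ω ∧ IsOpen {x : ℝ | Quot.mk _ (Sum.inl x) ∈ Ω}) ∨
        Ω = Set.univ)) := by
  have hinj := comp_psiD_injective hc_fib
  have hsurj := pushCompare_surjective hc_quot.surjective hp
  have hpne : ∀ v, c (psiD v) ≠ p := fun v hv => by
    obtain ⟨u, hu⟩ := Disk.exists_norm_eq_one
    rcases (hc_fib (psiD v) u).1 (hv.trans (hp u hu).symm) with h | h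
    · exact (norm_psi_lt_one v).ne ((congrArg (fun w : Disk => ‖w.1‖) h).trans hu)
    · exact (norm_psi_lt_one v).ne h.1
  refine ⟨hinj, hc_cont.comp continuous_psiD, ⟨pushCompare_injective hinj hpne, hsurj⟩,
    fun Ω => ⟨fun hΩ => ?_, ?_⟩⟩
  · obtain ⟨h1, h2⟩ := (Push.isOpen_iff hc_quot Ω).1 hΩ
    by_cases hpΩ : (Quot.mk _ (Sum.inr p) : Push c) ∈ Ω
    · refine Or.inr (Set.eq_univ_of_forall fun y => ?_)
      obtain ⟨x | _, rfl⟩ := hsurj y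
      · obtain ⟨v, rfl, hv⟩ := exists_psiD_mem_of_isOpen h2
          (fun u hu => by rw [Set.mem_ofPred_eq, hp u hu]; exact hpΩ) x
        rw [Set.mem_ofPred_eq, Push.mk_inr_eq] at hv
        exact hv
      · exact hpΩ
    · exact Or.inl ⟨hpΩ, h1⟩
  · rintro (⟨hpΩ, hU⟩ | rfl)
    · refine (Push.isOpen_iff hc_quot Ω).2 ⟨hU, ?_⟩
      have hopen : IsOpen ({u : E2 | ‖u‖ < 1} ∩
          (fun u => psiInv u 0) ⁻¹' {x : ℝ | (Quot.mk _ (Sum.inl x) : Push c) ∈ Ω}) := by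
        refine ContinuousOn.isOpen_inter_preimage ?_ (isOpen_lt continuous_norm continuous_const) hU
        exact (EuclideanSpace.proj (𝕜 := ℝ) (0 : Fin 2)).continuous.comp_continuousOn
          continuousOn_psiInv
      convert hopen.preimage (continuous_subtype_val : Continuous (Subtype.val : Disk → E2)) using 1
      ext u
      rcases u.norm_lt_one_or_eq_one with hu | hu
      · have := Push.mk_inr_eq c (psiInv u.1)
        rw [psiD_psiInv hu] at this
        simp [this, hu]
      · simp [hp u hu, hpΩ, hu]
    · exact isOpen_univ

end
end

section
/- There exists a weak S-homotopy equivalence of flows f : X → Y such that the branching spaces P⁻X and P⁻Y are not weakly homotopy equivalent: there is no continuous map between P⁻X and P⁻Y (in either direction) inducing a bijection on path components and isomorphisms on all homotopy groups at every basepoint. -/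
set_option maxHeartbeats 1000000

/-- A flow: a topological space of non-constant execution paths over a discrete
`0`-skeleton of states, with a continuous associative partial composition law.
(Discreteness of the `0`-skeleton is encoded by requiring the fibers of the
source and target maps to be open, i.e. `s` and `t` are continuous into the
discrete space of states.) -/
structure GFlow where
  States : Type
  Paths : Type
  [top : TopologicalSpace Paths]
  s : Paths → States
  t : Paths → States
  isOpen_sFiber : ∀ α : States, IsOpen {x : Paths | s x = α}
  isOpen_tFiber : ∀ α : States, IsOpen {x : Paths | t x = α}
  comp : (x y : Paths) → t x = s y → Paths
  continuous_comp : Continuous fun p : {p : Paths × Paths // t p.1 = s p.2} =>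
    comp p.1.1 p.1.2 p.2
  s_comp : ∀ x y h, s (comp x y h) = s x
  t_comp : ∀ x y h, t (comp x y h) = t y
  comp_assoc : ∀ x y z (hxy : t x = s y) (hyz : t y = s z)
    (h₁ : t (comp x y hxy) = s z) (h₂ : t x = s (comp y z hyz)),
    comp (comp x y hxy) z h₁ = comp x (comp y z hyz) h₂

attribute [instance] GFlow.top

/-- A morphism of flows. -/
structure FlowHom (X Y : GFlow) where
  f0 : X.States → Y.States
  pf : X.Paths → Y.Paths
  continuous_pf : Continuous pf
  s_pf : ∀ x, Y.s (pf x) = f0 (X.s x)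
  t_pf : ∀ x, Y.t (pf x) = f0 (X.t x)
  comp_pf : ∀ x y (h : X.t x = X.s y) (h' : Y.t (pf x) = Y.s (pf y)),
    pf (X.comp x y h) = Y.comp (pf x) (pf y) h'

/-- Composition of morphisms of flows. -/
def FlowHom.compHom {X Y Z : GFlow} (g : FlowHom Y Z) (f : FlowHom X Y) : FlowHom X Z where
  f0 := g.f0 ∘ f.f0
  pf := g.pf ∘ f.pf
  continuous_pf := g.continuous_pf.comp f.continuous_pf
  s_pf := fun x => by simp [Function.comp, g.s_pf, f.s_pf]
  t_pf := fun x => by simp [Function.comp, g.t_pf, f.t_pf]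
  comp_pf := fun x y h h' => by
    have h1 : Y.t (f.pf x) = Y.s (f.pf y) := by rw [f.t_pf, f.s_pf, h]
    have h2 : Z.t (g.pf (f.pf x)) = Z.s (g.pf (f.pf y)) := by rw [g.t_pf, g.s_pf, h1]
    simp only [Function.comp]
    rw [f.comp_pf x y h h1, g.comp_pf _ _ h1 h2]

/-- The identity morphism of a flow. -/
def FlowHom.id (X : GFlow) : FlowHom X X where
  f0 := fun α => α
  pf := fun x => x
  continuous_pf := continuous_id
  s_pf := fun _ => rfl
  t_pf := fun _ => rfl
  comp_pf := fun _ _ _ _ => rfl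
/-- A relation is a "closed equivalence relation compatible with branchings" if it is an
equivalence relation whose graph is closed and which identifies `x` with `x * y`. -/
def IsBranchCompatRel (X : GFlow) (r : X.Paths → X.Paths → Prop) : Prop :=
  Equivalence r ∧ IsClosed {p : X.Paths × X.Paths | r p.1 p.2} ∧
    ∀ x y (h : X.t x = X.s y), r x (X.comp x y h)

/-- The smallest closed equivalence relation containing all pairs `(x, x * y)`. -/
def BranchRel (X : GFlow) (a b : X.Paths) : Prop :=
  ∀ r, IsBranchCompatRel X r → r a b

/-- The setoid underlying the branching space. -/
def branchSetoid (X : GFlow) : Setoid X.Paths :=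
  ⟨BranchRel X, ⟨fun a _ hr => hr.1.refl a, fun h r hr => hr.1.symm (h r hr),
    fun h1 h2 r hr => hr.1.trans (h1 r hr) (h2 r hr)⟩⟩

/-- The branching space of a flow: the quotient of the path space by the smallest
closed equivalence relation identifying `x` and `x * y`. -/
def BranchSpace (X : GFlow) : Type :=
  Quotient (branchSetoid X)

instance (X : GFlow) : TopologicalSpace (BranchSpace X) :=
  inferInstanceAs (TopologicalSpace (Quotient (branchSetoid X)))

/-- The canonical map `h⁻` from the path space to the branching space. -/
def hminus (X : GFlow) : X.Paths → BranchSpace X :=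
  Quotient.mk (branchSetoid X)

theorem continuous_hminus (X : GFlow) : Continuous (hminus X) :=
  continuous_quotient_mk'

theorem BranchRel.map {X Y : GFlow} (f : FlowHom X Y) {a b : X.Paths}
    (h : BranchRel X a b) : BranchRel Y (f.pf a) (f.pf b) := by
  intro r hr
  refine h (fun u v => r (f.pf u) (f.pf v))
    ⟨⟨fun u => hr.1.refl _, fun h' => hr.1.symm h', fun h1 h2 => hr.1.trans h1 h2⟩, ?_, ?_⟩
  · have : {p : X.Paths × X.Paths | r (f.pf p.1) (f.pf p.2)} =
        (Prod.map f.pf f.pf) ⁻¹' {q : Y.Paths × Y.Paths | r q.1 q.2} := rfl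
    rw [this]
    exact hr.2.1.preimage (f.continuous_pf.prodMap f.continuous_pf)
  · intro x y hxy
    have h' : Y.t (f.pf x) = Y.s (f.pf y) := by rw [f.t_pf, f.s_pf, hxy]
    rw [f.comp_pf x y hxy h']
    exact hr.2.2 _ _ h'

/-- The map induced on branching spaces by a morphism of flows. -/
def branchMap {X Y : GFlow} (f : FlowHom X Y) : BranchSpace X → BranchSpace Y :=
  Quotient.map' f.pf (fun _ _ h => h.map f)

theorem continuous_branchMap {X Y : GFlow} (f : FlowHom X Y) :
    Continuous (branchMap f) :=
  f.continuous_pf.quotient_map' _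

/-- The map induced on branching spaces, as a continuous map. -/
def branchCMap {X Y : GFlow} (f : FlowHom X Y) : C(BranchSpace X, BranchSpace Y) :=
  ⟨branchMap f, continuous_branchMap f⟩
open Topology in
/-- The map induced by a continuous map on path components. -/
def zerothMap {A B : Type} [TopologicalSpace A] [TopologicalSpace B] (f : C(A, B)) :
    ZerothHomotopy A → ZerothHomotopy B :=
  Quot.map f (fun _ _ h => Nonempty.map (fun γ => γ.map f.continuous) h)

open Topology in
/-- The map induced by a continuous map on homotopy "groups" (sets of homotopy classes of
generalized loops rel boundary). -/
def piMap (N : Type) {A B : Type} [TopologicalSpace A] [TopologicalSpace B] (f : C(A, B))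
    (a : A) : HomotopyGroup N A a → HomotopyGroup N B (f a) :=
  Quot.map
    (fun p => (⟨f.comp p.1, fun y hy => by simp [p.2 y hy]⟩ : GenLoop N B (f a)))
    (fun p q h => Nonempty.map (fun (F : p.1.HomotopyRel q.1 (Cube.boundary N)) =>
      F.compContinuousMap f) h)

/-- A continuous map is a weak homotopy equivalence when it induces a bijection on path
components and isomorphisms on all homotopy groups at every basepoint. -/
def IsWeakHomotopyEquiv {A B : Type} [TopologicalSpace A] [TopologicalSpace B]
    (f : C(A, B)) : Prop :=
  Function.Bijective (zerothMap f) ∧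
  ∀ (n : ℕ) (a : A), Function.Bijective (piMap (Fin (n + 1)) f a)
/-- The endomap of `C ⊕ ℕ` which is `T` on the first summand and the successor on the second. -/
def sumShift {C : Type} (T : C → C) : C ⊕ ℕ → C ⊕ ℕ :=
  Sum.map T Nat.succ

theorem sumShift_iterate_inl {C : Type} (T : C → C) (k : ℕ) (c : C) :
    (sumShift T)^[k] (Sum.inl c) = Sum.inl (T^[k] c) := by
  induction k generalizing c with
  | zero => rfl
  | succ k ih => exact ih (T c)

theorem sumShift_iterate_inr {C : Type} (T : C → C) (k n : ℕ) :
    (sumShift T)^[k] (Sum.inr n) = Sum.inr (n + k) := by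
  induction k generalizing n with
  | zero => rfl
  | succ k ih => exact (ih (n + 1)).trans (by rw [Nat.add_right_comm, Nat.add_assoc])

/-- The flow of a discrete dynamical system `T : C → C`: the paths from `false` to `true` are the
points of `C`, the paths from `true` to itself are the natural numbers, and `c * k = T^[k] c`. -/
def iterateFlow (C : Type) [TopologicalSpace C] (T : C → C) (hT : Continuous T) : GFlow where
  States := Bool
  Paths := C ⊕ ℕ
  s := Sum.elim (fun _ => false) (fun _ => true)
  t := fun _ => true
  isOpen_sFiber := fun α => (isOpen_discrete {α}).preimage
    (Continuous.sumElim continuous_const continuous_const)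
  isOpen_tFiber := fun α => (isOpen_discrete {α}).preimage continuous_const
  comp := fun x y _ => (sumShift T)^[Sum.elim (fun _ => 0) id y] x
  continuous_comp := by
    have hact : Continuous fun p : (C ⊕ ℕ) × ℕ => (sumShift T)^[p.2] p.1 :=
      continuous_prod_of_discrete_right.mpr fun k =>
        (hT.sumMap continuous_of_discreteTopology).iterate k
    have hsh : Continuous (Sum.elim (fun _ => 0) id : C ⊕ ℕ → ℕ) :=
      continuous_const.sumElim continuous_id
    exact hact.comp
      ((continuous_fst.comp continuous_subtype_val).prodMk
        (hsh.comp (continuous_snd.comp continuous_subtype_val)))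
  s_comp := by
    rintro (c | n) y _
    · rw [sumShift_iterate_inl]; rfl
    · rw [sumShift_iterate_inr]; rfl
  t_comp := fun _ _ _ => rfl
  comp_assoc := by
    rintro x (c | m) (d | k) hxy hyz _ _
    · cases hxy
    · cases hxy
    · cases hyz
    · rw [sumShift_iterate_inr]
      simp only [Sum.elim_inr, id]
      rw [Nat.add_comm, Function.iterate_add_apply]

/-- An equivariant continuous map of dynamical systems induces a morphism of flows. -/
def iterateFlowMap {C D : Type} [TopologicalSpace C] [TopologicalSpace D] {T : C → C} {S : D → D}
    (hT : Continuous T) (hS : Continuous S) (g : C → D) (hg : Continuous g)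
    (h : Function.Semiconj g T S) : FlowHom (iterateFlow C T hT) (iterateFlow D S hS) where
  f0 := id
  pf := Sum.map g id
  continuous_pf := hg.sumMap continuous_id
  s_pf := by rintro (c | n) <;> rfl
  t_pf := fun _ => rfl
  comp_pf := by
    have hsemi : Function.Semiconj (Sum.map g id) (sumShift T) (sumShift S) := by
      rintro (c | n)
      · exact congrArg Sum.inl (h c)
      · rfl
    rintro x (c | k) _ _
    · rfl
    · exact hsemi.iterate_right k x

theorem subsingleton_homotopyGroup {A : Type} [TopologicalSpace A] [TotallyDisconnectedSpace A]
    (n : ℕ) (a : A) : Subsingleton (HomotopyGroup (Fin (n + 1)) A a) := by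
  have key : ∀ (p : GenLoop (Fin (n + 1)) A a) y, p y = a := fun p y =>
    ((isPreconnected_range p.1.continuous).subsingleton ⟨y, rfl⟩ ⟨0, rfl⟩).trans
      (p.2 0 ⟨0, Or.inl rfl⟩)
  have : Subsingleton (GenLoop (Fin (n + 1)) A a) :=
    ⟨fun p q => GenLoop.ext _ _ fun y => (key p y).trans (key q y).symm⟩
  exact inferInstanceAs (Subsingleton (Quotient _))

theorem Joined.eq_of_totallyDisconnected {A : Type} [TopologicalSpace A]
    [TotallyDisconnectedSpace A] {a b : A} (h : Joined a b) : a = b := by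
  obtain ⟨γ⟩ := h
  exact (isPreconnected_range γ.continuous).subsingleton ⟨0, γ.source⟩ ⟨1, γ.target⟩

/-- A continuous bijection between totally disconnected spaces is a weak homotopy equivalence. -/
theorem isWeakHomotopyEquiv_of_bijective {A B : Type} [TopologicalSpace A] [TopologicalSpace B]
    [TotallyDisconnectedSpace A] [TotallyDisconnectedSpace B] (f : C(A, B))
    (hf : Function.Bijective f) : IsWeakHomotopyEquiv f := by
  refine ⟨⟨?_, ?_⟩, fun n a => ?_⟩
  · rintro ⟨a⟩ ⟨b⟩ h
    have hab : Joined (f a) (f b) := Quotient.exact (s := pathSetoid B) h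
    rw [hf.1 hab.eq_of_totallyDisconnected]
  · rintro ⟨b⟩
    obtain ⟨a, rfl⟩ := hf.2 b
    exact ⟨Quot.mk _ a, rfl⟩
  · have := subsingleton_homotopyGroup n a
    have := subsingleton_homotopyGroup n (f a)
    exact ⟨fun _ _ _ => Subsingleton.elim _ _,
      fun _ => ⟨Quot.mk _ GenLoop.const, Subsingleton.elim _ _⟩⟩

/-- The shift `n ↦ n + 1` on `ℕ ∪ {∞}`, fixing `∞`. -/
def onePointSucc : OnePoint ℕ → OnePoint ℕ :=
  OnePoint.map Nat.succ

theorem continuous_onePointSucc : Continuous onePointSucc :=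
  OnePoint.continuous_map continuous_of_discreteTopology
    (by simpa [Nat.cofinite_eq_atTop] using Filter.tendsto_add_atTop_nat 1)

/-- The discrete variant of the shift on `ℕ ∪ {∞}`. -/
def discreteFlow : GFlow :=
  iterateFlow (ℕ ⊕ Unit) (Sum.map Nat.succ id) continuous_of_discreteTopology

/-- The flow of the shift on the one-point compactification `ℕ ∪ {∞}`. -/
def compactFlow : GFlow :=
  iterateFlow (OnePoint ℕ) onePointSucc continuous_onePointSucc

/-- The comparison map from the discrete flow to the compactified one. -/
def discreteToCompact : FlowHom discreteFlow compactFlow :=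
  iterateFlowMap _ _ (Sum.elim (fun n => (n : OnePoint ℕ)) (fun _ => OnePoint.infty))
    continuous_of_discreteTopology (by rintro (n | _) <;> rfl)

theorem bijective_discreteToCompact : Function.Bijective discreteToCompact.pf := by
  have h : Function.Bijective
      (Sum.elim (fun n => (n : OnePoint ℕ)) (fun _ => OnePoint.infty) : ℕ ⊕ Unit → OnePoint ℕ) := by
    constructor
    · rintro (m | _) (n | _) h <;> simp_all
    · intro x
      induction x using OnePoint.rec with
      | infty => exact ⟨Sum.inr (), rfl⟩
      | coe n => exact ⟨Sum.inl n, rfl⟩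
  exact ⟨h.1.sumMap Function.injective_id, h.2.sumMap Function.surjective_id⟩

/-- A continuous invariant of paths that separates the three branching classes of
`discreteFlow`. -/
def discreteClass : discreteFlow.Paths → Fin 3 :=
  Sum.elim (Sum.elim (fun _ : ℕ => 0) (fun _ : Unit => 1)) (fun _ : ℕ => 2)

theorem continuous_discreteClass : Continuous discreteClass :=
  (continuous_const.sumElim continuous_const).sumElim continuous_const

theorem discreteClass_comp (x y : discreteFlow.Paths) (h : discreteFlow.t x = discreteFlow.s y) :
    discreteClass (discreteFlow.comp x y h) = discreteClass x := by
  have hstep : discreteClass ∘ sumShift (Sum.map Nat.succ id) = discreteClass := by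
    funext z
    rcases z with ((n | u) | n) <;> rfl
  change discreteClass ((sumShift (Sum.map Nat.succ id))^[Sum.elim (fun _ => 0) id y] x) = _
  generalize (Sum.elim (fun _ => 0) id y : ℕ) = k
  induction k generalizing x with
  | zero => rfl
  | succ k ih => exact (ih (sumShift _ x) h).trans (congrFun hstep x)

theorem BranchRel.discreteClass_eq {x y : discreteFlow.Paths} (h : BranchRel discreteFlow x y) :
    discreteClass x = discreteClass y :=
  h (fun a b => discreteClass a = discreteClass b)
    ⟨⟨fun _ => rfl, Eq.symm, Eq.trans⟩,
      isClosed_eq (continuous_discreteClass.comp continuous_fst)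
        (continuous_discreteClass.comp continuous_snd),
      fun x y h => (discreteClass_comp x y h).symm⟩

theorem exists_surjective_zerothHomotopy_discreteFlow :
    ∃ φ : ZerothHomotopy (BranchSpace discreteFlow) → Fin 3, Function.Surjective φ := by
  let φ : BranchSpace discreteFlow → Fin 3 :=
    Quotient.lift discreteClass fun _ _ h => BranchRel.discreteClass_eq h
  have hφ : Continuous φ := continuous_discreteClass.quotient_lift _
  refine ⟨Quot.lift φ fun a b h => ?_, fun i => ?_⟩
  · exact Joined.eq_of_totallyDisconnected (Nonempty.map (fun γ => γ.map hφ) h)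
  · have : ∃ x, discreteClass x = i := by
      fin_cases i
      exacts [⟨Sum.inl (Sum.inl 0), rfl⟩, ⟨Sum.inl (Sum.inr ()), rfl⟩, ⟨Sum.inr 0, rfl⟩]
    obtain ⟨x, rfl⟩ := this
    exact ⟨Quot.mk _ (hminus _ x), rfl⟩

theorem branchRel_compactFlow_inl (c : OnePoint ℕ) :
    BranchRel compactFlow (Sum.inl ((0 : ℕ) : OnePoint ℕ)) (Sum.inl c) := by
  intro r hr
  have hcl : IsClosed {c : OnePoint ℕ | r (Sum.inl ((0 : ℕ) : OnePoint ℕ)) (Sum.inl c)} :=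
    hr.2.1.preimage (continuous_const.prodMk continuous_inl)
  refine OnePoint.denseRange_coe.induction_on c hcl fun n => ?_
  have hn : onePointSucc^[n] ((0 : ℕ) : OnePoint ℕ) = (n : OnePoint ℕ) := by
    induction n with
    | zero => rfl
    | succ n ih => rw [Function.iterate_succ_apply', ih]; rfl
  have := hr.2.2 (Sum.inl ((0 : ℕ) : OnePoint ℕ)) (Sum.inr n) rfl
  rwa [show compactFlow.comp (Sum.inl ((0 : ℕ) : OnePoint ℕ)) (Sum.inr n) rfl =
    Sum.inl (n : OnePoint ℕ) from (sumShift_iterate_inl _ _ _).trans (congrArg Sum.inl hn)] at this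

theorem branchRel_compactFlow_inr (n : ℕ) :
    BranchRel compactFlow (Sum.inr 0) (Sum.inr n) := by
  intro r hr
  have := hr.2.2 (Sum.inr 0) (Sum.inr n) rfl
  rwa [show compactFlow.comp (Sum.inr 0) (Sum.inr n) rfl = Sum.inr n
    from (sumShift_iterate_inr _ _ _).trans (congrArg Sum.inr (Nat.zero_add n))] at this

theorem exists_surjective_to_zerothHomotopy_compactFlow :
    ∃ ψ : Fin 2 → ZerothHomotopy (BranchSpace compactFlow), Function.Surjective ψ := by
  refine ⟨![Quot.mk _ (hminus compactFlow (Sum.inl ((0 : ℕ) : OnePoint ℕ))),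
    Quot.mk _ (hminus compactFlow (Sum.inr 0))], ?_⟩
  rintro ⟨⟨c | n⟩⟩
  · exact ⟨0, congrArg (Quot.mk _)
      (Quotient.sound (s := branchSetoid compactFlow) (branchRel_compactFlow_inl c))⟩
  · exact ⟨1, congrArg (Quot.mk _)
      (Quotient.sound (s := branchSetoid compactFlow) (branchRel_compactFlow_inr n))⟩

theorem not_exists_surjective_zerothHomotopy :
    ¬ ∃ g : ZerothHomotopy (BranchSpace compactFlow) → ZerothHomotopy (BranchSpace discreteFlow),
      Function.Surjective g := by
  rintro ⟨g, hg⟩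
  obtain ⟨φ, hφ⟩ := exists_surjective_zerothHomotopy_discreteFlow
  obtain ⟨ψ, hψ⟩ := exists_surjective_to_zerothHomotopy_compactFlow
  simpa using Fintype.card_le_of_surjective _ (hφ.comp (hg.comp hψ))

/-- There exists a weak S-homotopy equivalence of flows `f : X → Y` such that the
branching spaces `P⁻X` and `P⁻Y` are not weakly homotopy equivalent (in either
direction). -/
theorem branchSpace_not_invariant_under_weak_S_homotopy :
    ∃ (X Y : GFlow) (f : FlowHom X Y),
      (Function.Bijective f.f0 ∧ IsWeakHomotopyEquiv ⟨f.pf, f.continuous_pf⟩) ∧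
      (¬ ∃ g : C(BranchSpace X, BranchSpace Y), IsWeakHomotopyEquiv g) ∧
      (¬ ∃ g : C(BranchSpace Y, BranchSpace X), IsWeakHomotopyEquiv g) := by
  have : TotallyDisconnectedSpace discreteFlow.Paths :=
    inferInstanceAs (TotallyDisconnectedSpace ((ℕ ⊕ Unit) ⊕ ℕ))
  have : TotallyDisconnectedSpace compactFlow.Paths :=
    inferInstanceAs (TotallyDisconnectedSpace (OnePoint ℕ ⊕ ℕ))
  refine ⟨discreteFlow, compactFlow, discreteToCompact, ⟨Function.bijective_id,
    isWeakHomotopyEquiv_of_bijective _ bijective_discreteToCompact⟩, ?_, ?_⟩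
  · rintro ⟨g, hg, -⟩
    exact not_exists_surjective_zerothHomotopy
      ⟨_, (Equiv.ofBijective _ hg).symm.surjective⟩
  · rintro ⟨g, hg, -⟩
    exact not_exists_surjective_zerothHomotopy ⟨_, hg.2⟩
end

section
/- If the commutative square of topological spaces U → V, U → W, V → X, W → X is a pushout in the category of topological spaces, then the square of flows Glob(U) → Glob(V), Glob(U) → Glob(W), Glob(V) → Glob(X), Glob(W) → Glob(X), obtained by applying the globe functor to each space and map, is a pushout in the category of flows. -/
set_option maxHeartbeats 1000000

/-- The globe of a topological space `Z`: two states `false = 0` and `true = 1`,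
path space `Z`, no composable pairs of paths. -/
def Glob (Z : Type) [TopologicalSpace Z] : GFlow where
  States := Bool
  Paths := Z
  s := fun _ => false
  t := fun _ => true
  isOpen_sFiber := fun α => by
    cases α
    · have : {x : Z | false = false} = Set.univ := by ext x; simp
      rw [this]; exact isOpen_univ
    · have : {x : Z | false = true} = (∅ : Set Z) := by ext x; simp
      rw [this]; exact isOpen_empty
  isOpen_tFiber := fun α => by
    cases α
    · have : {x : Z | true = false} = (∅ : Set Z) := by ext x; simp
      rw [this]; exact isOpen_empty
    · have : {x : Z | true = true} = Set.univ := by ext x; simp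
      rw [this]; exact isOpen_univ
  comp := fun _ _ h => absurd h (fun hh => Bool.noConfusion hh)
  continuous_comp := continuous_iff_continuousAt.2 fun p => absurd p.2 (fun hh => Bool.noConfusion hh)
  s_comp := fun _ _ h => absurd h (fun hh => Bool.noConfusion hh)
  t_comp := fun _ _ h => absurd h (fun hh => Bool.noConfusion hh)
  comp_assoc := fun _ _ _ hxy => absurd hxy (fun hh => Bool.noConfusion hh)

/-- The morphism of flows induced between globes by a continuous map. -/
def GlobMap {Z Z' : Type} [TopologicalSpace Z] [TopologicalSpace Z'] (g : C(Z, Z')) :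
    FlowHom (Glob Z) (Glob Z') where
  f0 := fun b => b
  pf := g
  continuous_pf := g.continuous
  s_pf := fun _ => rfl
  t_pf := fun _ => rfl
  comp_pf := fun _ _ h => absurd h (fun hh => Bool.noConfusion hh)
/-- Morphisms of flows are determined by their maps on states and on paths. -/
theorem FlowHom.ext_maps {X Y : GFlow} {f g : FlowHom X Y} (h0 : f.f0 = g.f0)
    (hp : f.pf = g.pf) : f = g := by
  cases f
  cases g
  cases h0
  cases hp
  rfl

/-- The legs of a cocone in topological spaces through which continuous maps factor in at most one
way are jointly surjective: a predicate holding on both images holds everywhere. -/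
theorem forall_of_factorization_unique {V W X : Type} [TopologicalSpace V] [TopologicalSpace W]
    [TopologicalSpace X] (j : C(V, X)) (k : C(W, X))
    (huniq : ∀ (T : Type) [TopologicalSpace T] (c d : C(X, T)),
      (∀ v, c (j v) = d (j v)) → (∀ w, c (k w) = d (k w)) → c = d)
    {P : X → Prop} (hV : ∀ v, P (j v)) (hW : ∀ w, P (k w)) (x : X) : P x := by
  let _ : TopologicalSpace Prop := ⊤
  have h := huniq Prop ⟨P, continuous_top⟩ ⟨fun _ => True, continuous_top⟩
    (fun v => eq_true (hV v)) (fun w => eq_true (hW w))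
  exact of_eq_true (DFunLike.congr_fun h x)

/-- A continuous map from `Z` to the path space of `T`, all of whose values have the same source
and the same target, is a morphism of flows out of the globe of `Z`. -/
def FlowHom.ofGlob {Z : Type} [TopologicalSpace Z] {T : GFlow} (f0 : Bool → T.States)
    (g : C(Z, T.Paths)) (hs : ∀ z, T.s (g z) = f0 false) (ht : ∀ z, T.t (g z) = f0 true) :
    FlowHom (Glob Z) T where
  f0 := f0
  pf := g
  continuous_pf := g.continuous
  s_pf := hs
  t_pf := ht
  comp_pf := fun _ _ h => absurd h (fun hh => Bool.noConfusion hh)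

/-- If a commutative square of topological spaces is a pushout in the category of
topological spaces, then the associated square of globes is a pushout in the category
of flows. -/
theorem glob_preserves_pushout
    (U V W X : Type) [TopologicalSpace U] [TopologicalSpace V] [TopologicalSpace W]
    [TopologicalSpace X]
    (iUV : C(U, V)) (iUW : C(U, W)) (jVX : C(V, X)) (jWX : C(W, X))
    (hcomm : ∀ u, jVX (iUV u) = jWX (iUW u))
    (hpushout : ∀ (T : Type) [TopologicalSpace T] (a : C(V, T)) (b : C(W, T)),
      (∀ u, a (iUV u) = b (iUW u)) →
      ∃! c : C(X, T), (∀ v, c (jVX v) = a v) ∧ (∀ w, c (jWX w) = b w)) :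
    ((GlobMap jVX).compHom (GlobMap iUV) = (GlobMap jWX).compHom (GlobMap iUW)) ∧
    ∀ (T : GFlow) (a : FlowHom (Glob V) T) (b : FlowHom (Glob W) T),
      a.compHom (GlobMap iUV) = b.compHom (GlobMap iUW) →
      ∃! c : FlowHom (Glob X) T,
        c.compHom (GlobMap jVX) = a ∧ c.compHom (GlobMap jWX) = b := by
  refine ⟨FlowHom.ext_maps rfl (funext hcomm), fun T a b hab => ?_⟩
  have h0 : a.f0 = b.f0 := congrArg FlowHom.f0 hab
  have hp : ∀ u, a.pf (iUV u) = b.pf (iUW u) := congrFun (congrArg FlowHom.pf hab)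
  have huniq : ∀ (S : Type) [TopologicalSpace S] (c d : C(X, S)),
      (∀ v, c (jVX v) = d (jVX v)) → (∀ w, c (jWX w) = d (jWX w)) → c = d :=
    fun S _ c d hV hW => (hpushout S (d.comp jVX) (d.comp jWX)
      (fun u => congrArg d (hcomm u))).unique ⟨hV, hW⟩ ⟨fun _ => rfl, fun _ => rfl⟩
  obtain ⟨c, ⟨hcV, hcW⟩, hc⟩ :=
    hpushout T.Paths ⟨a.pf, a.continuous_pf⟩ ⟨b.pf, b.continuous_pf⟩ hp
  have hs : ∀ x, T.s (c x) = a.f0 false :=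
    forall_of_factorization_unique jVX jWX huniq
      (fun v => (congrArg T.s (hcV v)).trans (a.s_pf v))
      (fun w => (congrArg T.s (hcW w)).trans ((b.s_pf w).trans (congrFun h0.symm false)))
  have ht : ∀ x, T.t (c x) = a.f0 true :=
    forall_of_factorization_unique jVX jWX huniq
      (fun v => (congrArg T.t (hcV v)).trans (a.t_pf v))
      (fun w => (congrArg T.t (hcW w)).trans ((b.t_pf w).trans (congrFun h0.symm true)))
  refine ⟨FlowHom.ofGlob a.f0 c hs ht,
    ⟨FlowHom.ext_maps rfl (funext hcV), FlowHom.ext_maps h0 (funext hcW)⟩, ?_⟩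
  rintro d ⟨rfl, hdW⟩
  refine FlowHom.ext_maps rfl (congrArg DFunLike.coe (hc ⟨d.pf, d.continuous_pf⟩ ⟨fun _ => rfl, ?_⟩))
  exact congrFun (congrArg FlowHom.pf hdW)
end

section
/- Let f, g : X → Y be morphisms of flows with f⁰ = g⁰, and suppose there exists a continuous map H : [0,1] × PX → PY such that H(0,·) = Pf, H(1,·) = Pg, and for each t ∈ [0,1] the pair (f⁰, H(t,·)) is a morphism of flows from X to Y. Then the induced continuous maps P⁻f and P⁻g from P⁻X to P⁻Y are homotopic. -/
set_option maxHeartbeats 1000000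

open unitInterval in
/-- The time-`t` slice of a homotopy through morphisms of flows. -/
def FlowHom.slice {X Y : GFlow} (f0 : X.States → Y.States) (H : C(I × X.Paths, Y.Paths))
    (t : I)
    (hmor : (∀ x, Y.s (H (t, x)) = f0 (X.s x)) ∧
      (∀ x, Y.t (H (t, x)) = f0 (X.t x)) ∧
      (∀ x y (h : X.t x = X.s y) (h' : Y.t (H (t, x)) = Y.s (H (t, y))),
        H (t, X.comp x y h) = Y.comp (H (t, x)) (H (t, y)) h')) : FlowHom X Y where
  f0 := f0
  pf := fun x => H (t, x)
  continuous_pf := by fun_prop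
  s_pf := hmor.1
  t_pf := hmor.2.1
  comp_pf := hmor.2.2

theorem isQuotientMap_hminus (X : GFlow) : Topology.IsQuotientMap (hminus X) :=
  isQuotientMap_quotient_mk'

open unitInterval in
/-- If two morphisms of flows are S-homotopic, then the induced continuous maps on
branching spaces are homotopic. -/
theorem branchMap_homotopic_of_S_homotopic {X Y : GFlow} (f g : FlowHom X Y)
    (hf0 : f.f0 = g.f0) (H : C(I × X.Paths, Y.Paths))
    (h0 : ∀ x, H (0, x) = f.pf x) (h1 : ∀ x, H (1, x) = g.pf x)
    (hmor : ∀ t : I,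
      (∀ x, Y.s (H (t, x)) = f.f0 (X.s x)) ∧
      (∀ x, Y.t (H (t, x)) = f.f0 (X.t x)) ∧
      (∀ x y (h : X.t x = X.s y) (h' : Y.t (H (t, x)) = Y.s (H (t, y))),
        H (t, X.comp x y h) = Y.comp (H (t, x)) (H (t, y)) h')) :
    (branchCMap f).Homotopic (branchCMap g) := by
  refine ⟨⟨⟨fun p => branchMap (FlowHom.slice f.f0 H p.1 (hmor p.1)) p.2, ?_⟩, ?_, ?_⟩⟩
  · exact (isQuotientMap_hminus X).continuous_lift_prod_right
      ((continuous_hminus Y).comp H.continuous)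
  · rintro ⟨x⟩
    exact congrArg (hminus Y) (h0 x)
  · rintro ⟨x⟩
    exact congrArg (hminus Y) (h1 x)
end

section
/- Let X and Y be flows that are S-homotopy equivalent, i.e., there exist morphisms of flows f : X → Y and g : Y → X such that g∘f is S-homotopic to the identity of X and f∘g is S-homotopic to the identity of Y. Then the branching spaces P⁻X and P⁻Y are homotopy equivalent topological spaces. -/
set_option maxHeartbeats 1000000

open unitInterval in
/-- Two morphisms of flows `f g : X → Y` with the same map on states are S-homotopic if
there is a continuous map `H : [0,1] × PX → PY` from `Pf` to `Pg` which is a morphism of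
flows at each time `t`. -/
def SHomotopic {X Y : GFlow} (f g : FlowHom X Y) : Prop :=
  f.f0 = g.f0 ∧
  ∃ H : C(I × X.Paths, Y.Paths),
    (∀ x, H (0, x) = f.pf x) ∧ (∀ x, H (1, x) = g.pf x) ∧
    ∀ t : I,
      (∀ x, Y.s (H (t, x)) = f.f0 (X.s x)) ∧
      (∀ x, Y.t (H (t, x)) = f.f0 (X.t x)) ∧
      (∀ x y (h : X.t x = X.s y) (h' : Y.t (H (t, x)) = Y.s (H (t, y))),
        H (t, X.comp x y h) = Y.comp (H (t, x)) (H (t, y)) h')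
theorem hminus_surjective (X : GFlow) : Function.Surjective (hminus X) :=
  Quotient.mk_surjective

open unitInterval in
/-- S-homotopic morphisms of flows induce homotopic maps on branching spaces. -/
theorem SHomotopic.homotopic_branchCMap {X Y : GFlow} {f g : FlowHom X Y}
    (h : SHomotopic f g) : (branchCMap f).Homotopic (branchCMap g) := by
  obtain ⟨-, H, h0, h1, hH⟩ := h
  let F (t : I) : FlowHom X Y :=
    { f0 := f.f0
      pf := fun x => H (t, x)
      continuous_pf := by fun_prop
      s_pf := (hH t).1
      t_pf := (hH t).2.1
      comp_pf := (hH t).2.2 }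
  let G : C(X.Paths, C(I, BranchSpace Y)) :=
    ContinuousMap.curry ⟨fun p => hminus Y (H (p.2, p.1)),
      (continuous_hminus Y).comp (H.continuous.comp continuous_swap)⟩
  let K : BranchSpace X → C(I, BranchSpace Y) :=
    Quotient.lift G fun a b hab => by
      ext t
      exact Quotient.sound (hab.map (F t))
  have hK : Continuous K := G.continuous.quotient_lift _
  refine ⟨⟨⟨fun p => K p.2 p.1, by fun_prop⟩, fun b => ?_, fun b => ?_⟩⟩
  · obtain ⟨x, rfl⟩ := hminus_surjective X b
    exact congrArg (hminus Y) (h0 x)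
  · obtain ⟨x, rfl⟩ := hminus_surjective X b
    exact congrArg (hminus Y) (h1 x)

theorem branchCMap_compHom {X Y Z : GFlow} (g : FlowHom Y Z) (f : FlowHom X Y) :
    branchCMap (g.compHom f) = (branchCMap g).comp (branchCMap f) := by
  ext b
  obtain ⟨x, rfl⟩ := hminus_surjective X b
  rfl

theorem branchCMap_id (X : GFlow) :
    branchCMap (FlowHom.id X) = ContinuousMap.id (BranchSpace X) := by
  ext b
  obtain ⟨x, rfl⟩ := hminus_surjective X b
  rfl

/-- If two flows are S-homotopy equivalent, their branching spaces are homotopy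
equivalent topological spaces. -/
theorem branchSpace_homotopyEquiv_of_S_homotopy_equiv (X Y : GFlow)
    (f : FlowHom X Y) (g : FlowHom Y X)
    (hgf : SHomotopic (g.compHom f) (FlowHom.id X))
    (hfg : SHomotopic (f.compHom g) (FlowHom.id Y)) :
    Nonempty (ContinuousMap.HomotopyEquiv (BranchSpace X) (BranchSpace Y)) := by
  refine ⟨⟨branchCMap f, branchCMap g, ?_, ?_⟩⟩
  · rw [← branchCMap_compHom, ← branchCMap_id]
    exact hgf.homotopic_branchCMap
  · rw [← branchCMap_compHom, ← branchCMap_id]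
    exact hfg.homotopic_branchCMap
end

section
/- Let X and Y be flows that are S-homotopy equivalent, i.e., there exist morphisms of flows f : X → Y and g : Y → X such that g∘f is S-homotopic to the identity of X and f∘g is S-homotopic to the identity of Y. Then the merging spaces P⁺X and P⁺Y are homotopy equivalent topological spaces. -/
set_option maxHeartbeats 1000000

/-- A relation is a "closed equivalence relation compatible with mergeings" if it is an
equivalence relation whose graph is closed and which identifies `y` with `x * y`. -/
def IsMergeCompatRel (X : GFlow) (r : X.Paths → X.Paths → Prop) : Prop :=
  Equivalence r ∧ IsClosed {p : X.Paths × X.Paths | r p.1 p.2} ∧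
    ∀ x y (h : X.t x = X.s y), r y (X.comp x y h)

/-- The smallest closed equivalence relation containing all pairs `(x, x * y)`. -/
def MergeRel (X : GFlow) (a b : X.Paths) : Prop :=
  ∀ r, IsMergeCompatRel X r → r a b

/-- The setoid underlying the mergeing space. -/
def mergeSetoid (X : GFlow) : Setoid X.Paths :=
  ⟨MergeRel X, ⟨fun a _ hr => hr.1.refl a, fun h r hr => hr.1.symm (h r hr),
    fun h1 h2 r hr => hr.1.trans (h1 r hr) (h2 r hr)⟩⟩

/-- The mergeing space of a flow: the quotient of the path space by the smallest
closed equivalence relation identifying `y` and `x * y`. -/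
def MergeSpace (X : GFlow) : Type :=
  Quotient (mergeSetoid X)

instance (X : GFlow) : TopologicalSpace (MergeSpace X) :=
  inferInstanceAs (TopologicalSpace (Quotient (mergeSetoid X)))

/-- The canonical map `h⁺` from the path space to the mergeing space. -/
def hplus (X : GFlow) : X.Paths → MergeSpace X :=
  Quotient.mk (mergeSetoid X)

theorem continuous_hplus (X : GFlow) : Continuous (hplus X) :=
  continuous_quotient_mk'

theorem MergeRel.map {X Y : GFlow} (f : FlowHom X Y) {a b : X.Paths}
    (h : MergeRel X a b) : MergeRel Y (f.pf a) (f.pf b) := by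
  intro r hr
  refine h (fun u v => r (f.pf u) (f.pf v))
    ⟨⟨fun u => hr.1.refl _, fun h' => hr.1.symm h', fun h1 h2 => hr.1.trans h1 h2⟩, ?_, ?_⟩
  · have : {p : X.Paths × X.Paths | r (f.pf p.1) (f.pf p.2)} =
        (Prod.map f.pf f.pf) ⁻¹' {q : Y.Paths × Y.Paths | r q.1 q.2} := rfl
    rw [this]
    exact hr.2.1.preimage (f.continuous_pf.prodMap f.continuous_pf)
  · intro x y hxy
    have h' : Y.t (f.pf x) = Y.s (f.pf y) := by rw [f.t_pf, f.s_pf, hxy]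
    rw [f.comp_pf x y hxy h']
    exact hr.2.2 _ _ h'

/-- The map induced on mergeing spaces by a morphism of flows. -/
def mergeMap {X Y : GFlow} (f : FlowHom X Y) : MergeSpace X → MergeSpace Y :=
  Quotient.map' f.pf (fun _ _ h => h.map f)

theorem continuous_mergeMap {X Y : GFlow} (f : FlowHom X Y) :
    Continuous (mergeMap f) :=
  f.continuous_pf.quotient_map' _

/-- The map induced on mergeing spaces, as a continuous map. -/
def mergeCMap {X Y : GFlow} (f : FlowHom X Y) : C(MergeSpace X, MergeSpace Y) :=
  ⟨mergeMap f, continuous_mergeMap f⟩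
open unitInterval in
/-- S-homotopic morphisms of flows induce homotopic maps on merging spaces. -/
theorem SHomotopic.homotopic_mergeCMap {X Y : GFlow} {f g : FlowHom X Y}
    (h : SHomotopic f g) : (mergeCMap f).Homotopic (mergeCMap g) := by
  obtain ⟨-, H, H0, H1, hH⟩ := h
  let Ht (t : I) : FlowHom X Y :=
    { f0 := f.f0
      pf := fun x => H (t, x)
      continuous_pf := by fun_prop
      s_pf := (hH t).1
      t_pf := (hH t).2.1
      comp_pf := (hH t).2.2 }
  let K : I × MergeSpace X → MergeSpace Y := fun p => mergeMap (Ht p.1) p.2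
  have hK : Continuous K := by
    -- Since `I` is locally compact, `I × -` preserves quotient maps.
    let A : C(X.Paths × I, MergeSpace Y) :=
      ⟨fun p => hplus Y (H (p.2, p.1)), (continuous_hplus Y).comp (by fun_prop)⟩
    let B : MergeSpace X → C(I, MergeSpace Y) := Quotient.lift A.curry fun a b hab => by
      ext t
      exact Quotient.sound (MergeRel.map (Ht t) hab)
    have hB : Continuous B := A.curry.continuous.quotient_lift _
    have hKB : K = fun p => B p.2 p.1 := by
      ext ⟨t, x⟩
      induction x using Quotient.inductionOn with
      | h x => rfl
    rw [hKB]
    exact continuous_eval.comp ((hB.comp continuous_snd).prodMk continuous_fst)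
  refine ⟨⟨⟨K, hK⟩, fun x => ?_, fun x => ?_⟩⟩
  · induction x using Quotient.inductionOn with
    | h x => exact congrArg (hplus Y) (H0 x)
  · induction x using Quotient.inductionOn with
    | h x => exact congrArg (hplus Y) (H1 x)

theorem mergeCMap_id (X : GFlow) : mergeCMap (FlowHom.id X) = ContinuousMap.id _ := by
  ext x
  induction x using Quotient.inductionOn with
  | h x => rfl

theorem mergeCMap_compHom {X Y Z : GFlow} (g : FlowHom Y Z) (f : FlowHom X Y) :
    mergeCMap (g.compHom f) = (mergeCMap g).comp (mergeCMap f) := by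
  ext x
  induction x using Quotient.inductionOn with
  | h x => rfl

/-- If two flows are S-homotopy equivalent, their merging spaces are homotopy
equivalent topological spaces. -/
theorem mergeSpace_homotopyEquiv_of_S_homotopy_equiv (X Y : GFlow)
    (f : FlowHom X Y) (g : FlowHom Y X)
    (hgf : SHomotopic (g.compHom f) (FlowHom.id X))
    (hfg : SHomotopic (f.compHom g) (FlowHom.id Y)) :
    Nonempty (ContinuousMap.HomotopyEquiv (MergeSpace X) (MergeSpace Y)) := by
  refine ⟨⟨mergeCMap f, mergeCMap g, ?_, ?_⟩⟩
  · simpa only [mergeCMap_compHom, mergeCMap_id] using hgf.homotopic_mergeCMap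
  · simpa only [mergeCMap_compHom, mergeCMap_id] using hfg.homotopic_mergeCMap
end
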